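/- Trace generating function (complete form): let δ=(δ_1,...,δ_h) be a profile, u_0,u_1,... formal variables, and U_j = u_0 u_1 ⋯ u_{j−1}. The sum over all skew doubled shifted plane partitions ω=(λ^0,λ^1,...,λ^h) with profile δ of ∏_{i=0}^h u_i^{|λ^i|} equals ∏_{1≤i<j≤h, δ_i>δ_j} (1 − U_i^{−1}U_j)^{−1} · Φ({U_i : δ_i=−1}) · ∏_{k≥1} Φ({U_i^{−δ_i} U_{h+1}^k : 1≤i≤h})/(1 − U_{h+1}^k), as an identity of formal power series. -/

import Mathlib

open scoped BigOperators

/-- An integer partition: a weakly decreasing, finitely supported sequence of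
nonnegative integers. -/
structure Ptn where
  toFun : ℕ →₀ ℕ
  antitone' : ∀ ⦃i j : ℕ⦄, i ≤ j → toFun j ≤ toFun i

namespace Ptn
/-- the `i`-th part (0-indexed) -/
def part (lam : Ptn) (i : ℕ) : ℕ := lam.toFun i
/-- the size `|λ|` -/
def size (lam : Ptn) : ℕ := lam.toFun.sum fun _ k => k
end Ptn

/-- `HStrip μ λ` means `μ ≺ λ`, i.e. `λ/μ` is a horizontal strip:
`λ_i ≥ μ_i ≥ λ_{i+1}` for all `i`. -/
def HStrip (mu lam : Ptn) : Prop :=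
  ∀ i : ℕ, mu.part i ≤ lam.part i ∧ lam.part (i + 1) ≤ mu.part i
/-- Chains of partitions `μ = c 0 ≺ c 1 ≺ ⋯` stabilizing at `λ`; these encode
semistandard Young tableaux of shape `λ/μ` with entries in `{0, 1, 2, …}`. -/
def IsSchurChain (mu lam : Ptn) (c : ℕ → Ptn) : Prop :=
  c 0 = mu ∧ (∀ i, HStrip (c i) (c (i + 1))) ∧ ∃ N, ∀ i, N ≤ i → c i = lam

/-- the monomial attached to a chain: the variable `X i` records the cells added
at step `i` of the chain -/
noncomputable def chainWeight {R : Type*} [CommRing R] (X : ℕ → R) (c : ℕ → Ptn) : R :=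
  ∏ᶠ i : ℕ, X i ^ ((c (i + 1)).size - (c i).size)

/-- the skew Schur function `s_{λ/μ}(X)` (which is `0` if `μ ⊄ λ`) -/
noncomputable def skewSchur {R : Type*} [CommRing R] [TopologicalSpace R]
    (X : ℕ → R) (lam mu : Ptn) : R :=
  ∑' c : {c : ℕ → Ptn // IsSchurChain mu lam c}, chainWeight X c.1

/-- `Ψ(X,Y) = ∏_{i,j} (1 - x_i y_j)⁻¹` -/
noncomputable def Psi {R : Type*} [CommRing R] [TopologicalSpace R] [Inv R] (X Y : ℕ → R) : R :=
  ∏' p : ℕ × ℕ, (1 - X p.1 * Y p.2)⁻¹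

/-- `Φ(X) = ∏_i (1 - x_i)⁻¹ ∏_{i<j} (1 - x_i x_j)⁻¹` -/
noncomputable def Phi {R : Type*} [CommRing R] [TopologicalSpace R] [Inv R] (X : ℕ → R) : R :=
  (∏' i : ℕ, (1 - X i)⁻¹) * ∏' p : {q : ℕ × ℕ // q.1 < q.2}, (1 - X p.1.1 * X p.1.2)⁻¹
/-- `δ` is a `±1`-profile on the indices `1, …, h` -/
def IsProfile (h : ℕ) (δ : ℕ → ℤ) : Prop := ∀ i, 1 ≤ i → i ≤ h → δ i = 1 ∨ δ i = -1

/-- A skew doubled shifted plane partition `ω = (λ^0, …, λ^{m-1})` with profile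
`(δ_1, …, δ_{m-1})`: if `δ_{i+1} = 1` then `λ^i ≺ λ^{i+1}`, and if
`δ_{i+1} = -1` then `λ^i ≻ λ^{i+1}`. -/
def IsDSPP (m : ℕ) (δ : ℕ → ℤ) (L : Fin m → Ptn) : Prop :=
  ∀ (i : ℕ) (hi : i + 1 < m),
    if δ (i + 1) = 1 then HStrip (L ⟨i, Nat.lt_of_succ_lt hi⟩) (L ⟨i + 1, hi⟩)
    else HStrip (L ⟨i + 1, hi⟩) (L ⟨i, Nat.lt_of_succ_lt hi⟩)
/-- the coefficientwise (product) topology on multivariate formal power series -/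
instance (σ : Type*) : TopologicalSpace (MvPowerSeries σ ℚ) :=
  inferInstanceAs (TopologicalSpace ((σ →₀ ℕ) → ℚ))

/-- the ambient ring: formal power series in the variables `u_0, u_1, …` -/
abbrev RU : Type := MvPowerSeries ℕ ℚ

/-- the formal variable `u_i` -/
noncomputable def u (i : ℕ) : RU := MvPowerSeries.X i

/-- `U_j = u_0 u_1 ⋯ u_{j-1}` -/
noncomputable def U (j : ℕ) : RU := ∏ t ∈ Finset.range j, u t

/-- `U_i⁻¹ U_j = u_i u_{i+1} ⋯ u_{j-1}` (for `i ≤ j`) -/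
noncomputable def Urat (i j : ℕ) : RU := ∏ t ∈ Finset.Ico i j, u t

section

open scoped ENNReal
open MvPowerSeries (coeff constantCoeff)

namespace Ptn

theorem ext_part {a b : Ptn} (h : ∀ i, a.part i = b.part i) : a = b := by
  cases a
  cases b
  congr
  exact Finsupp.ext h

theorem part_antitone (a : Ptn) : Antitone a.part := a.antitone'

theorem exists_part_eq_zero (a : Ptn) : ∃ N, a.part N = 0 := by
  obtain ⟨N, hN⟩ := a.toFun.support.finite_toSet.infinite_compl.nonempty
  exact ⟨N, by simpa [Ptn.part] using hN⟩

theorem part_eq_zero_of_le (a : Ptn) {M N : ℕ} (h : a.part M = 0) (hMN : M ≤ N) :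
    a.part N = 0 :=
  Nat.le_zero.mp (h ▸ a.part_antitone hMN)

theorem size_eq_sum_range (a : Ptn) {N : ℕ} (h : a.part N = 0) :
    a.size = ∑ i ∈ Finset.range N, a.part i := by
  refine Finsupp.sum_of_support_subset _ (fun i hi => ?_) _ (fun _ _ => rfl)
  rw [Finset.mem_range]
  by_contra hlt
  exact (Finsupp.mem_support_iff.mp hi) (a.part_eq_zero_of_le h (not_lt.mp hlt))

/-- The partition with a given weakly decreasing sequence of parts. -/
noncomputable def ofAntitone (f : ℕ → ℕ) (hf : Antitone f) (h0 : ∃ N, f N = 0) : Ptn where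
  toFun := Finsupp.ofSupportFinite f <| by
    obtain ⟨N, hN⟩ := h0
    refine (Set.finite_Iio N).subset fun i hi => ?_
    by_contra hlt
    exact hi (Nat.le_zero.mp (hN ▸ hf (not_lt.mp hlt)))
  antitone' := hf

@[simp] theorem part_ofAntitone (f : ℕ → ℕ) (hf : Antitone f) (h0 : ∃ N, f N = 0) (i : ℕ) :
    (ofAntitone f hf h0).part i = f i := rfl

end Ptn

namespace HStrip

theorem size_le {a b : Ptn} (h : HStrip a b) : a.size ≤ b.size := by
  obtain ⟨N, hN⟩ := b.exists_part_eq_zero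
  rw [a.size_eq_sum_range (Nat.le_zero.mp (hN ▸ (h N).1)), b.size_eq_sum_range hN]
  exact Finset.sum_le_sum fun i _ => (h i).1

theorem eq_of_size_eq {a b : Ptn} (h : HStrip a b) (hs : a.size = b.size) : a = b := by
  obtain ⟨N, hN⟩ := b.exists_part_eq_zero
  have ha : a.part N = 0 := Nat.le_zero.mp (hN ▸ (h N).1)
  rw [a.size_eq_sum_range ha, b.size_eq_sum_range hN] at hs
  refine Ptn.ext_part fun i => ?_
  by_cases hi : i < N
  · exact (Finset.sum_eq_sum_iff_of_le fun i _ => (h i).1).mp hs i (Finset.mem_range.mpr hi)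
  · rw [a.part_eq_zero_of_le ha (not_lt.mp hi), b.part_eq_zero_of_le hN (not_lt.mp hi)]

protected theorem refl (a : Ptn) : HStrip a a := fun i => ⟨le_rfl, a.part_antitone i.le_succ⟩

end HStrip

/-- The parts of the upper partition produced by the local toggle. -/
def toggleUp (a b k : Ptn) (n : ℕ) : ℕ → ℕ
  | 0 => max (a.part 0) (b.part 0) + n
  | i + 1 => max (a.part (i + 1)) (b.part (i + 1)) + min (a.part i) (b.part i) - k.part i

/-- The parts of the lower partition produced by the local toggle. -/
def toggleDown (a b l : Ptn) (i : ℕ) : ℕ :=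
  max (a.part (i + 1)) (b.part (i + 1)) + min (a.part i) (b.part i) - l.part (i + 1)

theorem toggleUp_bounds {a b k : Ptn} (ha : HStrip k a) (hb : HStrip k b) (n i : ℕ) :
    max (a.part i) (b.part i) ≤ toggleUp a b k n i ∧
      toggleUp a b k n (i + 1) ≤ min (a.part i) (b.part i) := by
  have h1 := ha i
  have h2 := hb i
  constructor
  · cases i with
    | zero => simp only [toggleUp]; omega
    | succ i =>
      have h3 := ha i
      have h4 := hb i
      simp only [toggleUp]
      omega
  · simp only [toggleUp]
    omega

theorem toggleDown_bounds {a b l : Ptn} (ha : HStrip a l) (hb : HStrip b l) (i : ℕ) :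
    toggleDown a b l i ≤ min (a.part i) (b.part i) ∧
      max (a.part (i + 1)) (b.part (i + 1)) ≤ toggleDown a b l i := by
  have h1 := ha i
  have h2 := hb i
  have h3 := ha (i + 1)
  have h4 := hb (i + 1)
  simp only [toggleDown]
  omega

/-- The local Robinson–Schensted–Knuth toggle: partitions above both `a` and `b` correspond to
a nonnegative integer together with a partition below both `a` and `b`. -/
noncomputable def toggle (a b : Ptn) :
    {l : Ptn // HStrip a l ∧ HStrip b l} ≃ ℕ × {k : Ptn // HStrip k a ∧ HStrip k b} where
  toFun l := (l.1.part 0 - max (a.part 0) (b.part 0),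
    ⟨Ptn.ofAntitone (toggleDown a b l.1)
      (antitone_nat_of_succ_le fun i => by
        have h1 := toggleDown_bounds l.2.1 l.2.2 i
        have h2 := toggleDown_bounds l.2.1 l.2.2 (i + 1)
        omega)
      (by
        obtain ⟨N, hN⟩ := a.exists_part_eq_zero
        have h1 := toggleDown_bounds l.2.1 l.2.2 N
        exact ⟨N, by omega⟩),
      fun i => by
        have h1 := toggleDown_bounds l.2.1 l.2.2 i
        simp only [Ptn.part_ofAntitone]
        omega,
      fun i => by
        have h1 := toggleDown_bounds l.2.1 l.2.2 i
        simp only [Ptn.part_ofAntitone]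
        omega⟩)
  invFun p :=
    ⟨Ptn.ofAntitone (toggleUp a b p.2.1 p.1)
      (antitone_nat_of_succ_le fun i => by
        have h1 := toggleUp_bounds p.2.2.1 p.2.2.2 p.1 i
        omega)
      (by
        obtain ⟨N, hN⟩ := a.exists_part_eq_zero
        have h1 := toggleUp_bounds p.2.2.1 p.2.2.2 p.1 N
        exact ⟨N + 1, by omega⟩),
      fun i => by
        have h1 := toggleUp_bounds p.2.2.1 p.2.2.2 p.1 i
        simp only [Ptn.part_ofAntitone]
        omega,
      fun i => by
        have h1 := toggleUp_bounds p.2.2.1 p.2.2.2 p.1 i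
        simp only [Ptn.part_ofAntitone]
        omega⟩
  left_inv l := by
    refine Subtype.ext (Ptn.ext_part fun i => ?_)
    cases i with
    | zero =>
      have h1 := l.2.1 0
      have h2 := l.2.2 0
      simp only [Ptn.part_ofAntitone, toggleUp]
      omega
    | succ i =>
      have h1 := l.2.1 i
      have h2 := l.2.2 i
      have h3 := l.2.1 (i + 1)
      have h4 := l.2.2 (i + 1)
      simp only [Ptn.part_ofAntitone, toggleUp, toggleDown]
      omega
  right_inv p := by
    refine Prod.ext ?_ (Subtype.ext (Ptn.ext_part fun i => ?_))
    · simp [toggleUp]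
    · have h1 := p.2.2.1 i
      have h2 := p.2.2.2 i
      simp only [Ptn.part_ofAntitone, toggleUp, toggleDown]
      omega

theorem toggle_symm_size (a b : Ptn) (p : ℕ × {k : Ptn // HStrip k a ∧ HStrip k b}) :
    ((toggle a b).symm p).1.size + p.2.1.size = a.size + b.size + p.1 := by
  obtain ⟨N₁, h₁⟩ := a.exists_part_eq_zero
  obtain ⟨N₂, h₂⟩ := b.exists_part_eq_zero
  set N := max N₁ N₂
  have ha : a.part N = 0 := a.part_eq_zero_of_le h₁ (le_max_left _ _)
  have hb : b.part N = 0 := b.part_eq_zero_of_le h₂ (le_max_right _ _)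
  have hk : p.2.1.part N = 0 := Nat.le_zero.mp (ha ▸ (p.2.2.1 N).1)
  have hl : ((toggle a b).symm p).1.part (N + 1) = 0 :=
    Nat.le_zero.mp (ha ▸ (((toggle a b).symm p).2.1 N).2)
  rw [a.size_eq_sum_range (a.part_eq_zero_of_le ha N.le_succ),
    b.size_eq_sum_range (b.part_eq_zero_of_le hb N.le_succ), Ptn.size_eq_sum_range _ hk,
    Ptn.size_eq_sum_range _ hl, Finset.sum_range_succ' _ N, add_right_comm,
    ← Finset.sum_add_distrib, ← Finset.sum_add_distrib]
  have h0 : ((toggle a b).symm p).1.part 0 = max (a.part 0) (b.part 0) + p.1 := rfl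
  have hs : ∀ i, ((toggle a b).symm p).1.part (i + 1) + p.2.1.part i =
      max (a.part (i + 1)) (b.part (i + 1)) + min (a.part i) (b.part i) := fun i => by
    have h1 := p.2.2.1 i
    have h2 := p.2.2.2 i
    change max (a.part (i + 1)) (b.part (i + 1)) + min (a.part i) (b.part i) - p.2.1.part i
      + _ = _
    omega
  have hm : ∀ i, a.part i + b.part i = max (a.part i) (b.part i) + min (a.part i) (b.part i) :=
    fun i => (max_add_min _ _).symm
  simp only [hs, h0, hm, Finset.sum_add_distrib]
  rw [Finset.sum_range_succ' (fun i => max (a.part i) (b.part i)),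
    Finset.sum_range_succ (fun i => min (a.part i) (b.part i)), ha, hb]
  simp only [min_self]
  omega

/-- Power series with coefficients in `[0, ∞]`, where every family can be summed. -/
abbrev ESeries : Type := MvPowerSeries ℕ ℝ≥0∞

namespace ESeries

variable {ι κ : Type*}

/-- The coefficientwise sum of an arbitrary family. -/
noncomputable def total (f : ι → ESeries) : ESeries := fun n => ∑' i, coeff n (f i)

theorem coeff_total (f : ι → ESeries) (n : ℕ →₀ ℕ) :
    coeff n (total f) = ∑' i, coeff n (f i) := rfl

theorem mul_total (a : ESeries) (f : ι → ESeries) : a * total f = total fun i => a * f i := by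
  classical
  ext n
  simp only [coeff_total, MvPowerSeries.coeff_mul, ← ENNReal.tsum_mul_left]
  rw [Summable.tsum_finsetSum fun _ _ => ENNReal.summable]

theorem total_mul (a : ESeries) (f : ι → ESeries) : total f * a = total fun i => f i * a := by
  simp only [mul_comm _ a, mul_total]

theorem total_comm (f : ι → κ → ESeries) :
    (total fun i => total fun j => f i j) = total fun j => total fun i => f i j := by
  ext n
  exact ENNReal.tsum_comm

theorem total_prod (f : ι × κ → ESeries) : total f = total fun i => total fun j => f (i, j) := by
  ext n
  exact ENNReal.tsum_prod'

theorem total_equiv (e : ι ≃ κ) (f : κ → ESeries) : (total fun i => f (e i)) = total f := by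
  ext n
  exact e.tsum_eq fun j => coeff n (f j)

theorem total_subtype (p : ι → Prop) [DecidablePred p] (f : ι → ESeries) :
    (total fun i : {i // p i} => f i) = total fun i => if p i then f i else 0 := by
  ext n
  simp only [coeff_total]
  refine (tsum_subtype {i | p i} fun i => coeff n (f i)).trans (tsum_congr fun i => ?_)
  by_cases h : p i <;> simp [h]

theorem total_eq_single (i : ι) (f : ι → ESeries) (h : ∀ j, j ≠ i → f j = 0) :
    total f = f i := by
  ext n
  exact tsum_eq_single i fun j hj => by simp [h j hj]

/-- The geometric series `∑ mᵏ`. -/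
noncomputable def geom (m : ESeries) : ESeries := total fun k : ℕ => m ^ k

theorem geom_eq (m : ESeries) : geom m = 1 + m * geom m := by
  have h : m * geom m = total fun k : ℕ => m ^ (k + 1) := by
    simp only [geom, mul_total, pow_succ']
  ext n
  rw [h, map_add, geom, coeff_total, coeff_total]
  exact (tsum_eq_zero_add' (f := fun k => coeff n (m ^ k)) ENNReal.summable).trans
    (by rw [pow_zero])

@[simp] theorem geom_zero : geom 0 = 1 := by
  rw [geom_eq, zero_mul, add_zero]

end ESeries

/-- Two power series agree in all degrees below `K`. -/
def EqBelow {R : Type*} [Semiring R] (K : ℕ) (a b : MvPowerSeries ℕ R) : Prop :=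
  ∀ n : ℕ →₀ ℕ, n.degree < K → coeff n a = coeff n b

namespace EqBelow

variable {R : Type*} [CommSemiring R] {K : ℕ} {a b c d : MvPowerSeries ℕ R}

theorem refl (a : MvPowerSeries ℕ R) : EqBelow K a a := fun _ _ => rfl

theorem symm (h : EqBelow K a b) : EqBelow K b a := fun n hn => (h n hn).symm

theorem trans (h : EqBelow K a b) (h' : EqBelow K b c) : EqBelow K a c :=
  fun n hn => (h n hn).trans (h' n hn)

theorem mono {L : ℕ} (hL : L ≤ K) (h : EqBelow K a b) : EqBelow L a b :=
  fun n hn => h n (hn.trans_le hL)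

theorem add (h : EqBelow K a b) (h' : EqBelow K c d) : EqBelow K (a + c) (b + d) :=
  fun n hn => by rw [map_add, map_add, h n hn, h' n hn]

theorem mul (h : EqBelow K a b) (h' : EqBelow K c d) : EqBelow K (a * c) (b * d) := by
  classical
  intro n hn
  rw [MvPowerSeries.coeff_mul, MvPowerSeries.coeff_mul]
  refine Finset.sum_congr rfl fun p hp => ?_
  rw [Finset.HasAntidiagonal.mem_antidiagonal] at hp
  have hdeg : p.1.degree + p.2.degree = n.degree := by rw [← hp, map_add]
  rw [h p.1 (by omega), h' p.2 (by omega)]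

theorem mul_right_zero (h : EqBelow K a 0) (c : MvPowerSeries ℕ R) : EqBelow K (a * c) 0 := by
  simpa using h.mul (refl c)

theorem prod {ι : Type*} (s : Finset ι) {f g : ι → MvPowerSeries ℕ R}
    (h : ∀ i ∈ s, EqBelow K (f i) (g i)) : EqBelow K (∏ i ∈ s, f i) (∏ i ∈ s, g i) := by
  classical
  induction s using Finset.induction_on with
  | empty => exact refl _
  | insert i s hi ih =>
    rw [Finset.prod_insert hi, Finset.prod_insert hi]
    exact (h i (Finset.mem_insert_self _ _)).mul
      (ih fun j hj => h j (Finset.mem_insert_of_mem hj))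

theorem pow_of_constantCoeff {q : MvPowerSeries ℕ R} (hq : constantCoeff q = 0) (K : ℕ) :
    EqBelow K (q ^ K) 0 := fun n hn => by
  rw [map_zero]
  exact MvPowerSeries.coeff_of_lt_order ((Nat.cast_lt.mpr hn).trans_le
    (MvPowerSeries.le_order_pow_of_constantCoeff_eq_zero K hq))

theorem total {ι : Type*} {f g : ι → ESeries} (h : ∀ i, EqBelow K (f i) (g i)) :
    EqBelow K (ESeries.total f) (ESeries.total g) :=
  fun n hn => tsum_congr fun i => h i n hn

theorem geom {m : ESeries} (h : EqBelow K m 0) : EqBelow K (ESeries.geom m) 1 := by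
  rw [ESeries.geom_eq]
  simpa using (refl (1 : ESeries)).add (h.mul_right_zero (ESeries.geom m))

theorem eq (h : ∀ K, EqBelow K a b) : a = b := by
  ext n
  exact h _ n (Nat.lt_succ_self _)

end EqBelow

namespace ESeries

/-- The matrix entry of a half vertex operator. -/
noncomputable def entry (x : ESeries) (a b : Ptn) : ESeries :=
  open Classical in if HStrip a b then x ^ (b.size - a.size) else 0

theorem total_entry_mul_entry (x y : ESeries) (a b : Ptn) :
    (total fun l => entry x a l * entry y b l) =
      geom (x * y) * total fun k => entry y k a * entry x k b := by
  classical
  have hl : ∀ l, entry x a l * entry y b l = if HStrip a l ∧ HStrip b l then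
      x ^ (l.size - a.size) * y ^ (l.size - b.size) else 0 := fun l => by
    simp only [entry]
    split_ifs <;> simp_all
  have hk : ∀ k, entry y k a * entry x k b = if HStrip k a ∧ HStrip k b then
      y ^ (a.size - k.size) * x ^ (b.size - k.size) else 0 := fun l => by
    simp only [entry]
    split_ifs <;> simp_all
  simp only [hl, hk]
  rw [← total_subtype (fun l => HStrip a l ∧ HStrip b l)
    (fun l => x ^ (l.size - a.size) * y ^ (l.size - b.size)), ← total_subtype
    (fun k => HStrip k a ∧ HStrip k b) (fun k => y ^ (a.size - k.size) * x ^ (b.size - k.size)),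
    ← total_equiv (toggle a b).symm (fun l => x ^ (l.1.size - a.size) * y ^ (l.1.size - b.size)),
    total_prod, geom, total_mul]
  congr 1
  funext n
  rw [mul_total]
  congr 1
  funext k
  have hs := toggle_symm_size a b (n, k)
  have h1 := k.2.1.size_le
  have h2 := k.2.2.size_le
  simp only at hs
  rw [show ((toggle a b).symm (n, k)).1.size - a.size = n + (b.size - k.1.size) by omega,
    show ((toggle a b).symm (n, k)).1.size - b.size = n + (a.size - k.1.size) by omega]
  ring

theorem entry_one_mul_entry (x : ESeries) (a b : Ptn) :
    entry x a b * entry 1 a b = entry x a b := by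
  unfold entry
  split_ifs <;> simp

theorem total_entry (x : ESeries) (a : Ptn) :
    (total fun l => entry x a l) = geom x * total fun k => entry x k a := by
  have h := total_entry_mul_entry x 1 a a
  simpa only [entry_one_mul_entry, mul_comm (entry 1 _ _), mul_one] using h

theorem entry_self (x : ESeries) (a : Ptn) : entry x a a = 1 := by
  simp [entry, HStrip.refl]

theorem entry_eqBelow {K : ℕ} {x : ESeries} (hx : EqBelow K x 0) {a b : Ptn} (hab : a ≠ b) :
    EqBelow K (entry x a b) 0 := by
  unfold entry
  split_ifs with h
  · have hlt : a.size < b.size := lt_of_le_of_ne h.size_le fun hs => hab (h.eq_of_size_eq hs)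
    rw [← Nat.succ_pred_eq_of_pos (Nat.sub_pos_of_lt hlt), pow_succ']
    exact hx.mul_right_zero _
  · exact EqBelow.refl _

/-- Sum over all partitions obtained by adding a horizontal strip. -/
noncomputable def up (x : ESeries) (v : Ptn → ESeries) : Ptn → ESeries :=
  fun a => total fun l => entry x a l * v l

/-- Sum over all partitions obtained by removing a horizontal strip. -/
noncomputable def down (x : ESeries) (v : Ptn → ESeries) : Ptn → ESeries :=
  fun a => total fun k => entry x k a * v k

/-- Multiplication by `q` to the size. -/
noncomputable def energy (q : ESeries) (v : Ptn → ESeries) : Ptn → ESeries :=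
  fun a => q ^ a.size * v a

theorem up_smul (x c : ESeries) (v : Ptn → ESeries) : up x (c • v) = c • up x v := by
  funext a
  simp only [up, Pi.smul_apply, smul_eq_mul, mul_total, mul_left_comm]

theorem down_smul (x c : ESeries) (v : Ptn → ESeries) : down x (c • v) = c • down x v := by
  funext a
  simp only [down, Pi.smul_apply, smul_eq_mul, mul_total, mul_left_comm]

theorem energy_smul (q c : ESeries) (v : Ptn → ESeries) :
    energy q (c • v) = c • energy q v := by
  funext a
  simp only [energy, Pi.smul_apply, smul_eq_mul, mul_left_comm]

theorem total_smul (c : ESeries) (v : Ptn → ESeries) : total (c • v) = c * total v :=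
  (mul_total c v).symm

theorem up_down (x y : ESeries) (v : Ptn → ESeries) :
    up x (down y v) = geom (x * y) • down y (up x v) := by
  funext a
  have h1 : up x (down y v) a = total fun b => (total fun l => entry x a l * entry y b l) * v b := by
    simp only [up, down, mul_total, total_mul]
    rw [total_comm]
    simp only [mul_assoc]
  rw [h1]
  simp only [total_entry_mul_entry, Pi.smul_apply, smul_eq_mul, up, down, mul_total, total_mul]
  rw [total_comm]
  simp only [mul_assoc]

theorem up_one (x : ESeries) : up x 1 = geom x • down x 1 := by
  funext a
  simpa [up, down] using total_entry x a

theorem total_down (x : ESeries) (v : Ptn → ESeries) :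
    total (down x v) = geom x * total (up x v) := by
  have h1 : total (down x v) = total fun k => (total fun a => entry x k a) * v k := by
    simp only [total_mul]
    exact total_comm _
  have h2 : total (up x v) = total fun l => (total fun a => entry x a l) * v l := by
    simp only [total_mul]
    exact total_comm _
  rw [h1, h2, mul_total]
  simp only [total_entry, mul_assoc]

theorem up_energy (x q : ESeries) (v : Ptn → ESeries) :
    up x (energy q v) = energy q (up (q * x) v) := by
  funext a
  simp only [up, energy, mul_total]
  congr 1
  funext l
  simp only [entry]
  split_ifs with h
  · obtain ⟨d, hd⟩ := Nat.exists_eq_add_of_le h.size_le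
    rw [hd, Nat.add_sub_cancel_left]
    ring
  · simp

theorem energy_down (x q : ESeries) (v : Ptn → ESeries) :
    energy q (down x v) = down (q * x) (energy q v) := by
  funext a
  simp only [down, energy, mul_total]
  congr 1
  funext k
  simp only [entry]
  split_ifs with h
  · obtain ⟨d, hd⟩ := Nat.exists_eq_add_of_le h.size_le
    rw [hd, Nat.add_sub_cancel_left]
    ring
  · simp

theorem energy_energy (p q : ESeries) (v : Ptn → ESeries) :
    energy p (energy q v) = energy (p * q) v := by
  funext a
  simp only [energy, mul_pow, mul_assoc]

theorem up_eqBelow {K : ℕ} {x : ESeries} (hx : EqBelow K x 0) {v w : Ptn → ESeries}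
    (hv : ∀ a, EqBelow K (v a) (w a)) (a : Ptn) : EqBelow K (up x v a) (w a) := by
  classical
  refine EqBelow.trans (EqBelow.total (g := fun l => if l = a then w a else 0) fun l => ?_) ?_
  · split_ifs with h
    · subst h
      simpa [entry_self] using hv l
    · exact (entry_eqBelow hx (Ne.symm h)).mul_right_zero _
  · rw [total_eq_single a _ fun j hj => if_neg hj, if_pos rfl]
    exact EqBelow.refl _

theorem down_eqBelow {K : ℕ} {x : ESeries} (hx : EqBelow K x 0) {v w : Ptn → ESeries}
    (hv : ∀ a, EqBelow K (v a) (w a)) (a : Ptn) : EqBelow K (down x v a) (w a) := by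
  classical
  refine EqBelow.trans (EqBelow.total (g := fun l => if l = a then w a else 0) fun l => ?_) ?_
  · split_ifs with h
    · subst h
      simpa [entry_self] using hv l
    · exact (entry_eqBelow hx h).mul_right_zero _
  · rw [total_eq_single a _ fun j hj => if_neg hj, if_pos rfl]
    exact EqBelow.refl _

theorem up_zero (v : Ptn → ESeries) : up 0 v = v :=
  funext fun a => EqBelow.eq fun _ => up_eqBelow (EqBelow.refl _) (fun _ => EqBelow.refl _) a

theorem down_zero (v : Ptn → ESeries) : down 0 v = v :=
  funext fun a => EqBelow.eq fun _ => down_eqBelow (EqBelow.refl _) (fun _ => EqBelow.refl _) a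

end ESeries

/-- Removing a full column of height `K + 1`, as often as possible, from a partition with at
most `K + 1` parts. -/
noncomputable def columnEquiv (K : ℕ) :
    {l : Ptn // l.part (K + 1) = 0} ≃ ℕ × {l : Ptn // l.part K = 0} where
  toFun l := (l.1.part K,
    ⟨Ptn.ofAntitone (fun i => l.1.part i - l.1.part K)
      (fun _ _ hij => Nat.sub_le_sub_right (l.1.part_antitone hij) _) ⟨K, Nat.sub_self _⟩,
      Nat.sub_self _⟩)
  invFun p :=
    ⟨Ptn.ofAntitone (fun i => if i ≤ K then p.2.1.part i + p.1 else 0)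
      (antitone_nat_of_succ_le fun i => by
        have h : p.2.1.part (i + 1) ≤ p.2.1.part i := p.2.1.part_antitone i.le_succ
        split_ifs <;> omega)
      ⟨K + 1, by simp⟩, by simp⟩
  left_inv l := by
    refine Subtype.ext (Ptn.ext_part fun i => ?_)
    simp only [Ptn.part_ofAntitone]
    split_ifs with h
    · exact Nat.sub_add_cancel (l.1.part_antitone h)
    · exact (l.1.part_eq_zero_of_le l.2 (by omega)).symm
  right_inv p := by
    refine Prod.ext (by simp [p.2.2]) (Subtype.ext (Ptn.ext_part fun i => ?_))
    simp only [Ptn.part_ofAntitone, le_refl, if_true, p.2.2]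
    split_ifs with h
    · omega
    · rw [p.2.1.part_eq_zero_of_le p.2.2 (by omega), Nat.zero_sub]

theorem columnEquiv_symm_size (K : ℕ) (p : ℕ × {l : Ptn // l.part K = 0}) :
    ((columnEquiv K).symm p).1.size = (K + 1) * p.1 + p.2.1.size := by
  rw [Ptn.size_eq_sum_range _ ((columnEquiv K).symm p).2,
    p.2.1.size_eq_sum_range (p.2.1.part_eq_zero_of_le p.2.2 K.le_succ)]
  have h : ∀ i ∈ Finset.range (K + 1), ((columnEquiv K).symm p).1.part i = p.1 + p.2.1.part i :=
    fun i hi => by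
      have hi' : i ≤ K := Nat.lt_succ_iff.mp (Finset.mem_range.mp hi)
      change (if i ≤ K then _ else _) = _
      rw [if_pos hi', add_comm]
  rw [Finset.sum_congr rfl h, Finset.sum_add_distrib]
  simp

namespace ESeries

theorem total_size_of_part_eq_zero (q : ESeries) (K : ℕ) :
    (total fun l : {l : Ptn // l.part K = 0} => q ^ l.1.size) =
      ∏ k ∈ Finset.range K, geom (q ^ (k + 1)) := by
  induction K with
  | zero =>
    have h0 : ∀ l : {l : Ptn // l.part 0 = 0}, l.1.size = 0 := fun l => by
      rw [l.1.size_eq_sum_range l.2, Finset.sum_range_zero]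
    let z : {l : Ptn // l.part 0 = 0} := ⟨Ptn.ofAntitone (fun _ => 0) antitone_const ⟨0, rfl⟩, rfl⟩
    rw [total_eq_single z _ fun l hl => (hl (Subtype.ext (Ptn.ext_part fun i => ?_))).elim]
    · rw [h0, pow_zero, Finset.prod_range_zero]
    · exact l.1.part_eq_zero_of_le l.2 i.zero_le
  | succ K ih =>
    rw [Finset.prod_range_succ, ← ih, mul_comm, ← total_equiv (columnEquiv K).symm
      (fun l => q ^ l.1.size), total_prod, geom, total_mul]
    congr 1
    funext n
    rw [mul_total]
    congr 1
    funext l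
    rw [columnEquiv_symm_size, pow_add, pow_mul]

theorem total_size_eqBelow {q : ESeries} (hq : constantCoeff q = 0) (K : ℕ) :
    EqBelow K (total fun l : Ptn => q ^ l.size) (∏ k ∈ Finset.range K, geom (q ^ (k + 1))) := by
  rw [← total_size_of_part_eq_zero, total_subtype (fun l : Ptn => l.part K = 0)
    (fun l => q ^ l.size)]
  refine EqBelow.total fun l => ?_
  split_ifs with h
  · exact EqBelow.refl _
  · obtain ⟨N, hN⟩ := l.exists_part_eq_zero
    have hKN : K ≤ N := not_lt.mp fun hlt => h (l.part_eq_zero_of_le hN hlt.le)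
    have hsize : K ≤ l.size := by
      rw [l.size_eq_sum_range hN]
      calc K = ∑ i ∈ Finset.range K, 1 := by simp
        _ ≤ ∑ i ∈ Finset.range K, l.part i := Finset.sum_le_sum fun i hi =>
            (Nat.one_le_iff_ne_zero.mpr h).trans
              (l.part_antitone (Finset.mem_range.mp hi).le)
        _ ≤ ∑ i ∈ Finset.range N, l.part i :=
            Finset.sum_le_sum_of_subset (Finset.range_mono hKN)
    rw [← Nat.add_sub_of_le hsize, pow_add]
    exact (EqBelow.pow_of_constantCoeff hq K).mul_right_zero _

/-- Iterated `up`. -/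
noncomputable def ups (xs : List ESeries) (v : Ptn → ESeries) : Ptn → ESeries := xs.foldr up v

/-- Iterated `down`. -/
noncomputable def downs (ys : List ESeries) (v : Ptn → ESeries) : Ptn → ESeries :=
  ys.foldr down v

@[simp] theorem ups_nil (v : Ptn → ESeries) : ups [] v = v := rfl

@[simp] theorem ups_cons (x : ESeries) (xs : List ESeries) (v : Ptn → ESeries) :
    ups (x :: xs) v = up x (ups xs v) := rfl

@[simp] theorem downs_nil (v : Ptn → ESeries) : downs [] v = v := rfl

@[simp] theorem downs_cons (y : ESeries) (ys : List ESeries) (v : Ptn → ESeries) :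
    downs (y :: ys) v = down y (downs ys v) := rfl

theorem ups_append (xs xs' : List ESeries) (v : Ptn → ESeries) :
    ups (xs ++ xs') v = ups xs (ups xs' v) := List.foldr_append

theorem downs_append (ys ys' : List ESeries) (v : Ptn → ESeries) :
    downs (ys ++ ys') v = downs ys (downs ys' v) := List.foldr_append

theorem ups_smul (xs : List ESeries) (c : ESeries) (v : Ptn → ESeries) :
    ups xs (c • v) = c • ups xs v := by
  induction xs with
  | nil => rfl
  | cons x xs ih => rw [ups_cons, ih, up_smul, ups_cons]

theorem downs_smul (ys : List ESeries) (c : ESeries) (v : Ptn → ESeries) :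
    downs ys (c • v) = c • downs ys v := by
  induction ys with
  | nil => rfl
  | cons y ys ih => rw [downs_cons, ih, down_smul, downs_cons]

theorem up_downs (x : ESeries) (ys : List ESeries) (v : Ptn → ESeries) :
    up x (downs ys v) = (ys.map fun y => geom (x * y)).prod • downs ys (up x v) := by
  induction ys with
  | nil => simp
  | cons y ys ih =>
    rw [downs_cons, up_down, ih, down_smul, smul_smul, List.map_cons, List.prod_cons, downs_cons]

/-- The product `∏ (1 - x y)⁻¹` over all pairs from two lists. -/
noncomputable def psiList (xs ys : List ESeries) : ESeries :=
  (xs.map fun x => (ys.map fun y => geom (x * y)).prod).prod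

/-- The product `∏ (1 - xᵢ)⁻¹ ∏ (1 - xᵢ xⱼ)⁻¹` over a list. -/
noncomputable def phiList : List ESeries → ESeries
  | [] => 1
  | x :: xs => geom x * (xs.map fun x' => geom (x * x')).prod * phiList xs

theorem ups_downs (xs ys : List ESeries) (v : Ptn → ESeries) :
    ups xs (downs ys v) = psiList xs ys • downs ys (ups xs v) := by
  induction xs with
  | nil => simp [psiList]
  | cons x xs ih =>
    rw [ups_cons, ih, up_smul, up_downs, smul_smul, ups_cons, mul_comm]
    simp only [psiList, List.map_cons, List.prod_cons]

theorem ups_one (xs : List ESeries) : ups xs 1 = phiList xs • downs xs.reverse 1 := by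
  induction xs with
  | nil => simp [phiList]
  | cons x xs ih =>
    rw [ups_cons, ih, up_smul, up_downs, up_one, downs_smul, List.reverse_cons, downs_append,
      smul_smul, smul_smul, phiList, List.map_reverse, List.prod_reverse]
    congr 1
    ring

theorem total_downs (ys : List ESeries) (v : Ptn → ESeries) :
    total (downs ys v) = phiList ys * total (ups ys.reverse v) := by
  induction ys generalizing v with
  | nil => simp [phiList]
  | cons y ys ih =>
    rw [downs_cons, total_down, up_downs, total_smul, ih, List.reverse_cons, ups_append, phiList,
      ups_cons, ups_nil]
    ring

theorem ups_energy (xs : List ESeries) (q : ESeries) (v : Ptn → ESeries) :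
    ups xs (energy q v) = energy q (ups (xs.map (q * ·)) v) := by
  induction xs with
  | nil => rfl
  | cons x xs ih => rw [ups_cons, ih, up_energy, List.map_cons, ups_cons]

theorem energy_downs (ys : List ESeries) (q : ESeries) (v : Ptn → ESeries) :
    energy q (downs ys v) = downs (ys.map (q * ·)) (energy q v) := by
  induction ys with
  | nil => rfl
  | cons y ys ih => rw [downs_cons, energy_down, ih, List.map_cons, downs_cons]

theorem ups_eqBelow {K : ℕ} {xs : List ESeries} (hx : ∀ x ∈ xs, EqBelow K x 0)
    (v : Ptn → ESeries) (a : Ptn) : EqBelow K (ups xs v a) (v a) := by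
  induction xs generalizing a with
  | nil => exact EqBelow.refl _
  | cons x xs ih =>
    exact up_eqBelow (hx x List.mem_cons_self) (ih fun x' h => hx x' (List.mem_cons_of_mem _ h)) a

theorem downs_eqBelow {K : ℕ} {ys : List ESeries} (hy : ∀ y ∈ ys, EqBelow K y 0)
    (v : Ptn → ESeries) (a : Ptn) : EqBelow K (downs ys v a) (v a) := by
  induction ys generalizing a with
  | nil => exact EqBelow.refl _
  | cons y ys ih =>
    exact down_eqBelow (hy y List.mem_cons_self)
      (ih fun y' h => hy y' (List.mem_cons_of_mem _ h)) a

theorem phiList_perm {xs ys : List ESeries} (h : xs.Perm ys) : phiList xs = phiList ys := by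
  induction h with
  | nil => rfl
  | cons x h ih => rw [phiList, phiList, ih, (h.map _).prod_eq]
  | swap x y l =>
    simp only [phiList, List.map_cons, List.prod_cons, mul_comm x y]
    ring
  | trans _ _ ih ih' => exact ih.trans ih'

theorem psiList_perm {xs xs' ys ys' : List ESeries} (h : xs.Perm xs') (h' : ys.Perm ys') :
    psiList xs ys = psiList xs' ys' := by
  simp only [psiList, (h'.map _).prod_eq]
  exact (h.map _).prod_eq

theorem psiList_comm (xs ys : List ESeries) : psiList xs ys = psiList ys xs := by
  induction xs with
  | nil => simp [psiList]
  | cons x xs ih =>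
    simp only [psiList, List.map_cons, List.prod_cons, List.prod_map_mul, mul_comm _ x] at ih ⊢
    rw [ih]

/-- The sorted partition function. -/
noncomputable def sortedSum (q : ESeries) (ys xs : List ESeries) : ESeries :=
  total (downs ys (energy q (ups xs 1)))

/-- The factor gained when all variables travel once around the cylinder. -/
noncomputable def tripFactor (q : ESeries) (ys xs : List ESeries) (k : ℕ) : ESeries :=
  phiList (ys.map (q ^ k * ·)) * phiList (xs.map (q ^ k * ·)) *
    psiList (ys.map (q ^ (k + 1) * ·)) (xs.map (q ^ k * ·))

theorem psiList_map_mul (ys xs : List ESeries) (a b c d : ESeries) (h : a * b = c * d) :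
    psiList (ys.map (a * ·)) (xs.map (b * ·)) = psiList (ys.map (c * ·)) (xs.map (d * ·)) := by
  simp only [psiList, List.map_map, Function.comp_def, mul_mul_mul_comm, h]

theorem sortedSum_eq_mul (q : ESeries) (ys xs : List ESeries) :
    sortedSum q ys xs = tripFactor q ys xs 0 *
      sortedSum q (xs.reverse.map (q * ·)) (ys.reverse.map (q * ·)) := by
  have h1 : psiList ys.reverse ((xs.reverse).map (q * ·)) = psiList (ys.map (q * ·)) xs := by
    rw [psiList_perm ys.reverse_perm (xs.reverse_perm.map _)]
    simpa using psiList_map_mul ys xs 1 q q 1 (mul_comm _ _)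
  simp only [sortedSum, tripFactor, total_downs ys, ups_one, energy_smul, ups_smul, total_smul,
    ups_energy, ups_downs, energy_downs, pow_zero, one_mul, List.map_id',
    h1, zero_add, pow_one, mul_assoc]

theorem tripFactor_succ (q : ESeries) (ys xs : List ESeries) (k : ℕ) :
    tripFactor q (xs.reverse.map (q * ·)) (ys.reverse.map (q * ·)) k =
      tripFactor q ys xs (k + 1) := by
  simp only [tripFactor, List.map_map, Function.comp_def, ← mul_assoc, ← pow_succ]
  rw [phiList_perm (xs.reverse_perm.map _), phiList_perm (ys.reverse_perm.map _),
    psiList_perm (xs.reverse_perm.map _) (ys.reverse_perm.map _), psiList_comm,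
    psiList_map_mul _ _ (q ^ (k + 1)) _ (q ^ (k + 1 + 1)) (q ^ (k + 1)) (mul_comm _ _)]
  ring

theorem exists_sortedSum_eq (q : ESeries) (K : ℕ) (j : ℕ) (ys xs : List ESeries)
    (hy : ∀ y ∈ ys, q ^ j ∣ y) (hx : ∀ x ∈ xs, q ^ j ∣ x) :
    ∃ ys' xs' : List ESeries, (∀ y ∈ ys', q ^ (j + K) ∣ y) ∧ (∀ x ∈ xs', q ^ (j + K) ∣ x) ∧
      sortedSum q ys xs =
        (∏ k ∈ Finset.range K, tripFactor q ys xs k) * sortedSum q ys' xs' := by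
  induction K generalizing ys xs j with
  | zero => exact ⟨ys, xs, hy, hx, by simp⟩
  | succ K ih =>
    have hmap : ∀ zs : List ESeries, (∀ z ∈ zs, q ^ j ∣ z) →
        ∀ z ∈ zs.reverse.map (q * ·), q ^ (j + 1) ∣ z := fun zs hz z hmem => by
      obtain ⟨z', h', rfl⟩ := List.mem_map.mp hmem
      rw [pow_succ']
      exact mul_dvd_mul_left q (hz z' (List.mem_reverse.mp h'))
    obtain ⟨ys', xs', hy', hx', h⟩ := ih (j + 1) _ _ (hmap xs hx) (hmap ys hy)
    refine ⟨ys', xs', fun y h => ?_, fun x h => ?_, ?_⟩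
    · exact add_right_comm j 1 K ▸ hy' y h
    · exact add_right_comm j 1 K ▸ hx' x h
    · rw [sortedSum_eq_mul, h, Finset.prod_range_succ', ← mul_assoc]
      simp only [tripFactor_succ, mul_comm]

theorem sortedSum_eqBelow_of_small {q : ESeries} {K : ℕ} {ys xs : List ESeries}
    (hy : ∀ y ∈ ys, EqBelow K y 0) (hx : ∀ x ∈ xs, EqBelow K x 0) :
    EqBelow K (sortedSum q ys xs) (total fun l : Ptn => q ^ l.size) := by
  refine EqBelow.total fun l => (downs_eqBelow hy _ l).trans ?_
  simpa [energy] using (EqBelow.refl (q ^ l.size)).mul (ups_eqBelow hx 1 l)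

theorem sortedSum_eqBelow {q : ESeries} (hq : constantCoeff q = 0) (K : ℕ)
    (ys xs : List ESeries) :
    EqBelow K (sortedSum q ys xs) ((∏ k ∈ Finset.range K, tripFactor q ys xs k) *
      ∏ k ∈ Finset.range K, geom (q ^ (k + 1))) := by
  obtain ⟨ys', xs', hy, hx, h⟩ := exists_sortedSum_eq q K 0 ys xs (by simp) (by simp)
  have hsmall : ∀ z, q ^ (0 + K) ∣ z → EqBelow K z 0 := fun z ⟨c, hc⟩ => by
    rw [hc, zero_add]
    exact (EqBelow.pow_of_constantCoeff hq K).mul_right_zero c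
  rw [h]
  exact (EqBelow.refl _).mul ((sortedSum_eqBelow_of_small (fun y h => hsmall y (hy y h))
    fun x h => hsmall x (hx x h)).trans (total_size_eqBelow hq K))

end ESeries

namespace ESeries

/-- The transfer-matrix sum over sequences of partitions starting at a given one, where the
`i`-th step adds (weight `a i`) and removes (weight `b i`) horizontal strips. -/
noncomputable def word : ℕ → (ℕ → ESeries) → (ℕ → ESeries) → (ℕ → ESeries) → Ptn → ESeries
  | 0, u, _, _ => energy (u 0) 1
  | n + 1, u, a, b => energy (u 0) (down (b 0) (up (a 0)
      (word n (fun i => u (i + 1)) (fun i => a (i + 1)) fun i => b (i + 1))))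

theorem word_eq (n : ℕ) (u a b : ℕ → ESeries) :
    word n u a b = (∏ i : Fin n, ∏ j : Fin n, if i < j then
        geom (a i * b j * ∏ t ∈ Finset.Ico ((i : ℕ) + 1) (j + 1), u t) else 1) •
      downs (List.ofFn fun i : Fin n => b i * ∏ t ∈ Finset.range (i + 1), u t)
        (energy (∏ t ∈ Finset.range (n + 1), u t)
          (ups (List.ofFn fun i : Fin n => a i * ∏ t ∈ Finset.Ico ((i : ℕ) + 1) (n + 1), u t)
            1)) := by
  induction n generalizing u a b with
  | zero => simp [word]
  | succ n ih =>
    have hr : ∀ m, ∏ t ∈ Finset.range (m + 1), u t =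
        u 0 * ∏ t ∈ Finset.range m, u (t + 1) := fun m => by
      rw [Finset.prod_range_succ', mul_comm]
    have hI : ∀ i m, ∏ t ∈ Finset.Ico (i + 1) (m + 1), u t =
        ∏ t ∈ Finset.Ico i m, u (t + 1) := fun i m => (Finset.prod_Ico_add' u i m 1).symm
    rw [word, ih, up_smul, up_downs, up_energy, ← ups_cons, down_smul, down_smul, ← downs_cons,
      energy_smul, energy_smul, energy_downs, energy_energy, smul_smul]
    congr 1
    · rw [Fin.prod_univ_succ]
      simp only [Fin.prod_univ_succ (n := n), lt_self_iff_false, if_false, one_mul, Fin.succ_pos,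
        if_true, Fin.not_lt_zero, Fin.succ_lt_succ_iff, Fin.val_succ, Fin.val_zero, hI,
        List.map_ofFn, List.prod_ofFn, Function.comp_def, ← Finset.range_eq_Ico]
      rw [mul_comm]
      simp only [mul_assoc]
    · rw [List.ofFn_succ, List.ofFn_succ, List.map_cons, List.map_ofFn]
      simp only [Fin.val_succ, Fin.val_zero, hr, hI, Function.comp_def, ← Finset.range_eq_Ico,
        Finset.range_zero, Finset.prod_empty, mul_one, mul_left_comm, mul_comm (a 0), mul_comm (b 0)]

theorem phiList_ofFn {n : ℕ} (f : Fin n → ESeries) :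
    phiList (List.ofFn f) =
      (∏ i, geom (f i)) * ∏ i, ∏ j, if i < j then geom (f i * f j) else 1 := by
  induction n with
  | zero => simp [phiList]
  | succ n ih =>
    rw [List.ofFn_succ, phiList, ih]
    simp only [Fin.prod_univ_succ (n := n), if_false, one_mul, Fin.succ_pos, if_true,
      Fin.not_lt_zero, Fin.succ_lt_succ_iff, List.map_ofFn, List.prod_ofFn, Function.comp_def]
    ring

theorem psiList_ofFn {n : ℕ} (f g : Fin n → ESeries) :
    psiList (List.ofFn f) (List.ofFn g) = ∏ i, ∏ j, geom (f i * g j) := by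
  simp only [psiList, List.map_ofFn, List.prod_ofFn, Function.comp_def]

theorem prod_prod_eq_prod_lt {n : ℕ} (F : Fin n → Fin n → ESeries) :
    ∏ i, ∏ j, F i j = (∏ i, F i i) * ∏ i, ∏ j, if i < j then F i j * F j i else 1 := by
  induction n with
  | zero => simp
  | succ n ih =>
    simp only [Fin.prod_univ_succ (n := n), if_false, one_mul, Fin.succ_pos, if_true,
      Fin.not_lt_zero, Fin.succ_lt_succ_iff, Finset.prod_mul_distrib]
    rw [ih]
    ring

theorem phiList_ofFn_add {n : ℕ} (f g : Fin n → ESeries) (h : ∀ i, f i = 0 ∨ g i = 0) :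
    phiList (List.ofFn fun i => f i + g i) = phiList (List.ofFn f) * phiList (List.ofFn g) *
      psiList (List.ofFn f) (List.ofFn g) := by
  have h1 : ∀ i, geom (f i + g i) = geom (f i) * geom (g i) := fun i => by
    rcases h i with h | h <;> simp [h]
  have h2 : ∀ i j, geom ((f i + g i) * (f j + g j)) = geom (f i * f j) * geom (g i * g j) *
      (geom (f i * g j) * geom (f j * g i)) := fun i j => by
    rcases h i with hi | hi <;> rcases h j with hj | hj <;> simp [hi, hj, mul_comm]
  have h3 : ∀ i, geom (f i * g i) = 1 := fun i => by
    rcases h i with h | h <;> simp [h]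
  rw [psiList_ofFn, prod_prod_eq_prod_lt fun i j => geom (f i * g j)]
  simp only [phiList_ofFn, h1, h2, h3, Finset.prod_const_one, one_mul, Finset.prod_mul_distrib]
  have h4 : (∏ i, ∏ j, if i < j then geom (f i * f j) * geom (g i * g j) *
      (geom (f i * g j) * geom (f j * g i)) else 1) =
      (∏ i, ∏ j, if i < j then geom (f i * f j) else 1) *
      (∏ i, ∏ j, if i < j then geom (g i * g j) else 1) *
      (∏ i, ∏ j, if i < j then geom (f i * g j) * geom (f j * g i) else 1) := by
    simp only [← Finset.prod_mul_distrib]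
    refine Finset.prod_congr rfl fun i _ => Finset.prod_congr rfl fun j _ => ?_
    split_ifs <;> simp
  rw [h4]
  ring

theorem prod_tripFactor {n : ℕ} (q : ESeries) (y x : Fin n → ESeries)
    (h : ∀ i, y i = 0 ∨ x i = 0) (K : ℕ) :
    (∏ k ∈ Finset.range K, tripFactor q (List.ofFn y) (List.ofFn x) k) *
        phiList ((List.ofFn y).map (q ^ K * ·)) =
      phiList (List.ofFn y) * ∏ k ∈ Finset.range K,
        phiList (List.ofFn fun i => q ^ (k + 1) * y i + q ^ k * x i) := by
  induction K with
  | zero => simp [Function.comp_def]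
  | succ K ih =>
    rw [Finset.prod_range_succ, Finset.prod_range_succ, ← mul_assoc, ← ih, phiList_ofFn_add]
    · simp only [tripFactor, List.map_ofFn, Function.comp_def]
      ring
    · intro i
      rcases h i with h | h <;> simp [h]

theorem phiList_eqBelow {K : ℕ} {xs : List ESeries} (hx : ∀ x ∈ xs, EqBelow K x 0) :
    EqBelow K (phiList xs) 1 := by
  induction xs with
  | nil => exact EqBelow.refl _
  | cons x xs ih =>
    have hx0 := hx x List.mem_cons_self
    have hprod : EqBelow K (xs.map fun x' => geom (x * x')).prod 1 := by
      clear ih hx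
      induction xs with
      | nil => exact EqBelow.refl _
      | cons x' xs ih =>
        simpa using (hx0.mul_right_zero x').geom.mul ih
    simpa [phiList] using (hx0.geom.mul hprod).mul (ih fun x' h => hx x' (List.mem_cons_of_mem _ h))

theorem sortedSum_ofFn_eqBelow {n : ℕ} {q : ESeries} (hq : constantCoeff q = 0)
    (y x : Fin n → ESeries) (h : ∀ i, y i = 0 ∨ x i = 0) (K : ℕ) :
    EqBelow K (sortedSum q (List.ofFn y) (List.ofFn x))
      (phiList (List.ofFn y) * ∏ k ∈ Finset.range K,
        phiList (List.ofFn fun i => q ^ (k + 1) * y i + q ^ k * x i) * geom (q ^ (k + 1))) := by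
  refine (sortedSum_eqBelow hq K _ _).trans ?_
  rw [Finset.prod_mul_distrib, ← mul_assoc, ← prod_tripFactor q y x h]
  refine EqBelow.mul ?_ (EqBelow.refl _)
  have h1 : EqBelow K (phiList ((List.ofFn y).map (q ^ K * ·))) 1 := phiList_eqBelow fun z hz => by
    obtain ⟨z', -, rfl⟩ := List.mem_map.mp hz
    exact (EqBelow.pow_of_constantCoeff hq K).mul_right_zero z'
  simpa using (EqBelow.refl _).mul h1.symm

end ESeries

theorem isDSPP_cons {n : ℕ} (δ : ℕ → ℤ) (a : Ptn) (L : Fin (n + 1) → Ptn) :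
    IsDSPP (n + 2) δ (Fin.cons a L : Fin (n + 2) → Ptn) ↔
      (if δ 1 = 1 then HStrip a (L 0) else HStrip (L 0) a) ∧
        IsDSPP (n + 1) (fun i => δ (i + 1)) L := by
  constructor
  · intro h
    exact ⟨h 0 (Nat.succ_lt_succ n.succ_pos), fun i hi => h (i + 1) (by omega)⟩
  · rintro ⟨h0, h⟩ i hi
    cases i with
    | zero => exact h0
    | succ i => exact h i (by omega)

namespace ESeries

theorem down_up_eq (δ : ℤ) (v : Ptn → ESeries) (a : Ptn) :
    down (if δ = 1 then 0 else 1) (up (if δ = 1 then 1 else 0) v) a =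
      open Classical in
      total fun b => if (if δ = 1 then HStrip a b else HStrip b a) then v b else 0 := by
  classical
  by_cases hδ : δ = 1
  · simp [hδ, down_zero, up, entry]
  · simp [hδ, up_zero, down, entry]

theorem total_cons {n : ℕ} (f : (Fin (n + 1) → Ptn) → ESeries) :
    total f = total fun a => total fun L : Fin n → Ptn => f (Fin.cons a L) := by
  rw [← total_equiv (Fin.consEquiv fun _ => Ptn) f, total_prod]
  rfl

open Classical in
theorem word_eq_total (n : ℕ) (u : ℕ → ESeries) (δ : ℕ → ℤ) (a : Ptn) :
    word n u (fun i => if δ (i + 1) = 1 then 1 else 0) (fun i => if δ (i + 1) = 1 then 0 else 1) a =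
      total fun L : Fin n → Ptn => if IsDSPP (n + 1) δ (Fin.cons a L : Fin (n + 1) → Ptn) then
        u 0 ^ a.size * ∏ i : Fin n, u (i + 1) ^ (L i).size else 0 := by
  induction n generalizing u δ a with
  | zero =>
    rw [total_eq_single (fun i : Fin 0 => i.elim0) _ fun L hL => (hL (Subsingleton.elim _ _)).elim]
    have h : IsDSPP (0 + 1) δ (Fin.cons a fun i : Fin 0 => i.elim0 : Fin 1 → Ptn) :=
      fun i hi => by omega
    simp [word, energy, h]
  | succ n ih =>
    rw [word, energy, down_up_eq, mul_total, total_cons]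
    congr 1
    funext b
    have ih' := ih (fun i => u (i + 1)) (fun i => δ (i + 1)) b
    rw [ih']
    by_cases h : if δ 1 = 1 then HStrip a b else HStrip b a
    · simp only [zero_add, h, if_true, mul_total]
      congr 1
      funext L
      have hiff := isDSPP_cons δ a (Fin.cons b L : Fin (n + 1) → Ptn)
      simp only [Fin.cons_zero, h, true_and] at hiff
      simp only [hiff, Fin.prod_univ_succ, Fin.cons_zero, Fin.cons_succ,
        Fin.val_succ, Fin.val_zero, zero_add]
      split_ifs <;> simp
    · have hz : ∀ L : Fin n → Ptn,
          ¬ IsDSPP (n + 2) δ (Fin.cons a (Fin.cons b L : Fin (n + 1) → Ptn) : Fin (n + 2) → Ptn) :=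
        fun L hL => h ((isDSPP_cons δ a _).mp hL).1
      simp only [zero_add, h, if_false, mul_zero, hz]
      ext m
      simp [coeff_total]

theorem total_dspp (n : ℕ) (u : ℕ → ESeries) (δ : ℕ → ℤ) :
    (total fun ω : {L : Fin (n + 1) → Ptn // IsDSPP (n + 1) δ L} =>
        ∏ i : Fin (n + 1), u i ^ (ω.1 i).size) =
      total (word n u (fun i => if δ (i + 1) = 1 then 1 else 0)
        fun i => if δ (i + 1) = 1 then 0 else 1) := by
  classical
  rw [total_subtype (fun L : Fin (n + 1) → Ptn => IsDSPP (n + 1) δ L)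
    (fun L => ∏ i : Fin (n + 1), u i ^ (L i).size), total_cons]
  congr 1
  funext a
  rw [word_eq_total]
  simp only [Fin.prod_univ_succ, Fin.cons_zero, Fin.cons_succ, Fin.val_succ,
    Fin.val_zero]

theorem total_dspp_eqBelow (n : ℕ) (u : ℕ → ESeries) (hu : constantCoeff (u 0) = 0) (δ : ℕ → ℤ)
    (a b : ℕ → ESeries) (ha : a = fun i => if δ (i + 1) = 1 then 1 else 0)
    (hb : b = fun i => if δ (i + 1) = 1 then 0 else 1) (K : ℕ) :
    EqBelow K (total fun ω : {L : Fin (n + 1) → Ptn // IsDSPP (n + 1) δ L} =>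
        ∏ i : Fin (n + 1), u i ^ (ω.1 i).size)
      ((∏ i : Fin n, ∏ j : Fin n, if i < j then
          geom (a i * b j * ∏ t ∈ Finset.Ico ((i : ℕ) + 1) (j + 1), u t) else 1) *
        (phiList (List.ofFn fun i : Fin n => b i * ∏ t ∈ Finset.range (i + 1), u t) *
          ∏ k ∈ Finset.range K,
            phiList (List.ofFn fun i : Fin n =>
              (∏ t ∈ Finset.range (n + 1), u t) ^ (k + 1) *
                (b i * ∏ t ∈ Finset.range (i + 1), u t) +
              (∏ t ∈ Finset.range (n + 1), u t) ^ k *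
                (a i * ∏ t ∈ Finset.Ico ((i : ℕ) + 1) (n + 1), u t)) *
            geom ((∏ t ∈ Finset.range (n + 1), u t) ^ (k + 1)))) := by
  subst ha hb
  rw [total_dspp, word_eq, total_smul]
  refine (EqBelow.refl _).mul (sortedSum_ofFn_eqBelow ?_ _ _ (fun i => ?_) K)
  · rw [Finset.prod_range_succ', map_mul, hu, mul_zero]
  · by_cases h : δ (i + 1) = 1 <;> simp [h]

end ESeries

/-- A rational power series and a series over `[0, ∞]` have the same, natural, coefficients. -/
def SameCoeffs (P : RU) (Q : ESeries) : Prop :=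
  ∃ N : MvPowerSeries ℕ ℕ, MvPowerSeries.map (Nat.castRingHom ℚ) N = P ∧
    MvPowerSeries.map (Nat.castRingHom ℝ≥0∞) N = Q

namespace SameCoeffs

variable {P P' : RU} {Q Q' : ESeries}

theorem exists_nat (h : SameCoeffs P Q) (n : ℕ →₀ ℕ) :
    ∃ k : ℕ, coeff n P = k ∧ coeff n Q = k := by
  obtain ⟨N, rfl, rfl⟩ := h
  exact ⟨coeff n N, by simp, by simp⟩

theorem eqBelow_iff (h : SameCoeffs P Q) (h' : SameCoeffs P' Q') {K : ℕ} :
    EqBelow K P P' ↔ EqBelow K Q Q' := by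
  refine forall₂_congr fun n _ => ?_
  obtain ⟨k, hk, hk'⟩ := h.exists_nat n
  obtain ⟨l, hl, hl'⟩ := h'.exists_nat n
  rw [hk, hk', hl, hl', Nat.cast_inj, Nat.cast_inj]

theorem zero : SameCoeffs 0 0 := ⟨0, map_zero _, map_zero _⟩

theorem one : SameCoeffs 1 1 := ⟨1, map_one _, map_one _⟩

theorem X (i : ℕ) : SameCoeffs (MvPowerSeries.X i) (MvPowerSeries.X i) :=
  ⟨MvPowerSeries.X i, MvPowerSeries.map_X _ _, MvPowerSeries.map_X _ _⟩

theorem mul (h : SameCoeffs P Q) (h' : SameCoeffs P' Q') : SameCoeffs (P * P') (Q * Q') := by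
  obtain ⟨N, rfl, rfl⟩ := h
  obtain ⟨N', rfl, rfl⟩ := h'
  exact ⟨N * N', map_mul _ _ _, map_mul _ _ _⟩

theorem pow (h : SameCoeffs P Q) (k : ℕ) : SameCoeffs (P ^ k) (Q ^ k) := by
  obtain ⟨N, rfl, rfl⟩ := h
  exact ⟨N ^ k, map_pow _ _ _, map_pow _ _ _⟩

theorem prod {ι : Type*} (s : Finset ι) {f : ι → RU} {g : ι → ESeries}
    (h : ∀ i, SameCoeffs (f i) (g i)) : SameCoeffs (∏ i ∈ s, f i) (∏ i ∈ s, g i) := by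
  choose N hN hN' using h
  exact ⟨∏ i ∈ s, N i, by simp [hN], by simp [hN']⟩

theorem ite {p : Prop} [Decidable p] (h : p → SameCoeffs P Q) (h' : ¬ p → SameCoeffs P' Q') :
    SameCoeffs (if p then P else P') (if p then Q else Q') := by
  split_ifs with hp
  exacts [h hp, h' hp]

theorem inv_one_sub (h : SameCoeffs P Q) (hP : constantCoeff P = 0) :
    SameCoeffs (1 - P)⁻¹ (ESeries.geom Q) := by
  obtain ⟨N, rfl, rfl⟩ := h
  have hN : constantCoeff N = 0 := by
    simpa using hP
  have hz : ∀ (n : ℕ →₀ ℕ) (k : ℕ), n.degree < k → coeff n (N ^ k) = 0 := fun n k hk => by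
    simpa using EqBelow.pow_of_constantCoeff hN k n hk
  let G : MvPowerSeries ℕ ℕ := fun n => ∑ k ∈ Finset.range (n.degree + 1), coeff n (N ^ k)
  have hG : ∀ n, coeff n G = ∑ k ∈ Finset.range (n.degree + 1), coeff n (N ^ k) := fun n => rfl
  have hmap : MvPowerSeries.map (Nat.castRingHom ℝ≥0∞) G =
      ESeries.geom (MvPowerSeries.map (Nat.castRingHom ℝ≥0∞) N) := by
    ext n
    rw [ESeries.geom, ESeries.coeff_total, MvPowerSeries.coeff_map, hG]
    simp only [← map_pow, MvPowerSeries.coeff_map]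
    rw [tsum_eq_sum (s := Finset.range (n.degree + 1)), map_sum]
    intro k hk
    rw [hz n k (by simpa using hk), map_zero]
  have hinj : Function.Injective (MvPowerSeries.map (σ := ℕ) (Nat.castRingHom ℝ≥0∞)) :=
    fun A B hAB => by
      ext n
      simpa using congrArg (coeff n) hAB
  have hrec : G = 1 + N * G := hinj <| by
    rw [map_add, map_mul, map_one, hmap]
    exact ESeries.geom_eq _
  refine ⟨G, ?_, hmap⟩
  rw [MvPowerSeries.eq_inv_iff_mul_eq_one (by simp [hN])]
  have hrec' := congrArg (MvPowerSeries.map (Nat.castRingHom ℚ)) hrec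
  rw [map_add, map_mul, map_one] at hrec'
  linear_combination hrec'

end SameCoeffs

instance : T2Space RU := inferInstanceAs (T2Space ((ℕ →₀ ℕ) → ℚ))

theorem hasSum_coeff {ι : Type*} {f : ι → RU} {a : RU}
    (h : ∀ n, HasSum (fun i => coeff n (f i)) (coeff n a)) : HasSum f a :=
  (Pi.hasSum (f := fun i n => coeff n (f i)) (g := fun n => coeff n a)).mpr h

theorem SameCoeffs.hasSum {ι : Type*} {f : ι → RU} {g : ι → ESeries} {P : RU}
    (h : ∀ i, SameCoeffs (f i) (g i))
    (hP : ∀ n, ∃ k : ℕ, coeff n P = k ∧ coeff n (ESeries.total g) = k) : HasSum f P := by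
  refine hasSum_coeff fun n => ?_
  obtain ⟨k, hk, hk'⟩ := hP n
  choose w hw hw' using fun i => (h i).exists_nat n
  rw [ESeries.coeff_total] at hk'
  simp only [hw', hw] at hk' ⊢
  rw [hk]
  have hfin : (Function.support w).Finite := by
    refine (ENNReal.finite_const_le_of_tsum_ne_top (a := fun i => (w i : ℝ≥0∞))
      (by rw [hk']; exact ENNReal.natCast_ne_top k) one_ne_zero).subset fun i hi => ?_
    exact_mod_cast Nat.one_le_iff_ne_zero.mpr hi
  have hsum : ∑ i ∈ hfin.toFinset, w i = k := by
    rw [tsum_eq_sum (s := hfin.toFinset) (fun i hi => by simpa using hi)] at hk'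
    exact_mod_cast hk'
  rw [← hsum, Nat.cast_sum]
  exact hasSum_sum_of_ne_finset_zero fun i hi => by simpa using hi

theorem exists_hasProd_eqBelow {f : ℕ → RU} (hf : ∀ k, EqBelow k (f k) 1) :
    ∃ P : RU, HasProd f P ∧ ∀ K, EqBelow K P (∏ k ∈ Finset.range K, f k) := by
  have key : ∀ (n : ℕ →₀ ℕ) (s : Finset ℕ), Finset.range (n.degree + 1) ⊆ s →
      coeff n (∏ k ∈ s, f k) = coeff n (∏ k ∈ Finset.range (n.degree + 1), f k) := by
    intro n s hs
    rw [← Finset.prod_sdiff hs]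
    have h1 : EqBelow (n.degree + 1) (∏ k ∈ s \ Finset.range (n.degree + 1), f k)
        (∏ k ∈ s \ Finset.range (n.degree + 1), 1) :=
      EqBelow.prod _ fun k hk => (hf k).mono (by simpa using (Finset.mem_sdiff.mp hk).2)
    rw [Finset.prod_const_one] at h1
    simpa using h1.mul (EqBelow.refl (∏ k ∈ Finset.range (n.degree + 1), f k)) n (by omega)
  let P : RU := fun n => coeff n (∏ k ∈ Finset.range (n.degree + 1), f k)
  refine ⟨P, ?_, fun K n hn => (key n _ (Finset.range_subset_range.mpr hn)).symm⟩
  refine tendsto_pi_nhds.mpr fun n => tendsto_const_nhds.congr' ?_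
  filter_upwards [Filter.eventually_ge_atTop (Finset.range (n.degree + 1))] with s hs
  exact (key n s hs).symm

theorem Phi_eq {h : ℕ} {X : ℕ → RU} (hX : ∀ n, h ≤ n → X n = 0) :
    Phi X = (∏ i : Fin h, (1 - X i)⁻¹) *
      ∏ i : Fin h, ∏ j : Fin h, if i < j then (1 - X i * X j)⁻¹ else 1 := by
  have h0 : (1 - 0 : RU)⁻¹ = 1 := by
    rw [sub_zero, MvPowerSeries.inv_eq_iff_mul_eq_one (by simp), one_mul]
  rw [Phi]
  congr 1
  · rw [tprod_eq_prod (s := Finset.range h), Finset.prod_range]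
    intro n hn
    rw [hX n (by simpa using hn), h0]
  · let e : {p : Fin h × Fin h // p.1 < p.2} → {q : ℕ × ℕ // q.1 < q.2} :=
      fun p => ⟨(p.1.1, p.1.2), p.2⟩
    have he : Function.Injective e := fun p p' hpp' => by
      simp only [e, Subtype.mk.injEq, Prod.mk.injEq, Fin.val_inj] at hpp'
      exact Subtype.ext (Prod.ext hpp'.1 hpp'.2)
    rw [← Finset.prod_product', ← Finset.prod_filter, ← he.tprod_eq, tprod_fintype,
      Finset.univ_product_univ]
    · exact (Finset.prod_subtype (p := fun p : Fin h × Fin h => p.1 < p.2) _ (by simp)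
        fun p => (1 - X p.1 * X p.2)⁻¹).symm
    · intro q hq
      have hlt : q.1.2 < h := by
        by_contra hle
        refine hq ?_
        change (1 - X q.1.1 * X q.1.2)⁻¹ = 1
        rw [hX q.1.2 (not_lt.mp hle), mul_zero, h0]
      exact ⟨⟨(⟨q.1.1, q.2.trans hlt⟩, ⟨q.1.2, hlt⟩), q.2⟩, rfl⟩

theorem SameCoeffs.Phi {h : ℕ} {X : ℕ → RU} {Y : Fin h → ESeries} (hX : ∀ n, h ≤ n → X n = 0)
    (hc : ∀ n, constantCoeff (X n) = 0) (hXY : ∀ i : Fin h, SameCoeffs (X i) (Y i)) :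
    SameCoeffs (_root_.Phi X) (ESeries.phiList (List.ofFn Y)) := by
  rw [Phi_eq hX, ESeries.phiList_ofFn]
  exact (prod _ fun i => (hXY i).inv_one_sub (hc i)).mul (prod _ fun i => prod _ fun j =>
    ite (fun _ => ((hXY i).mul (hXY j)).inv_one_sub (by simp [hc])) fun _ => one)

theorem sameCoeffs_U (j : ℕ) : SameCoeffs (U j) (∏ t ∈ Finset.range j, MvPowerSeries.X t) :=
  SameCoeffs.prod _ SameCoeffs.X

theorem sameCoeffs_Urat (i j : ℕ) :
    SameCoeffs (Urat i j) (∏ t ∈ Finset.Ico i j, MvPowerSeries.X t) :=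
  SameCoeffs.prod _ SameCoeffs.X

theorem constantCoeff_U (j : ℕ) : constantCoeff (U (j + 1)) = 0 := by
  rw [U, Finset.prod_range_succ, map_mul, u, MvPowerSeries.constantCoeff_X, mul_zero]

theorem constantCoeff_Urat {i j : ℕ} (h : i < j) : constantCoeff (Urat i j) = 0 := by
  rw [Urat, map_prod]
  exact Finset.prod_eq_zero (Finset.left_mem_Ico.mpr h) (MvPowerSeries.constantCoeff_X i)

end

/-- **Trace generating function, complete form** (Theorem 3.2, equation (3.2)):
for a profile `δ = (δ_1, …, δ_h)`,
`Σ_{ω ∈ DSPP_δ} ∏_{i=0}^h u_i^{|λ^i|}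
  = ∏_{1≤i<j≤h, δ_i>δ_j} (1 - U_i⁻¹ U_j)⁻¹ · Φ({U_i : δ_i = -1})
      · ∏_{k≥1} Φ({U_i^{-δ_i} U_{h+1}^k : 1 ≤ i ≤ h})/(1 - U_{h+1}^k)`.
Here the Laurent monomial `U_i⁻¹ U_{h+1}^k` (for `k ≥ 1`) is the genuine power
series `u_i u_{i+1} ⋯ u_h · U_{h+1}^{k-1} = Urat i (h+1) * U (h+1)^(k-1)`. -/
theorem trace_generating_function_complete (h : ℕ) (hh : 1 ≤ h) (δ : ℕ → ℤ)
    (hδ : IsProfile h δ) :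
    ∑' ω : {L : Fin (h + 1) → Ptn // IsDSPP (h + 1) δ L},
      ∏ i : Fin (h + 1), u (i : ℕ) ^ (ω.1 i).size
    = (∏ q ∈ Finset.univ.filter
          (fun q : Fin h × Fin h => q.1 < q.2 ∧ δ ((q.1 : ℕ) + 1) > δ ((q.2 : ℕ) + 1)),
          (1 - Urat ((q.1 : ℕ) + 1) ((q.2 : ℕ) + 1))⁻¹) *
        Phi (fun n => if n < h ∧ δ (n + 1) = -1 then U (n + 1) else 0) *
        ∏' k : ℕ,
          Phi (fun n => if n < h then
              (if δ (n + 1) = -1 then U (n + 1) * U (h + 1) ^ (k + 1)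
                else Urat (n + 1) (h + 1) * U (h + 1) ^ k)
            else 0) *
            (1 - U (h + 1) ^ (k + 1))⁻¹ := by
  let a : ℕ → ESeries := fun i => if δ (i + 1) = 1 then 1 else 0
  let b : ℕ → ESeries := fun i => if δ (i + 1) = 1 then 0 else 1
  let q : ESeries := ∏ t ∈ Finset.range (h + 1), MvPowerSeries.X t
  have hsign : ∀ i : Fin h, (δ (i + 1) = 1 ∧ a i = 1 ∧ b i = 0) ∨
      (δ (i + 1) = -1 ∧ a i = 0 ∧ b i = 1) := fun i => by
    rcases hδ (i + 1) (by omega) (by omega) with hi | hi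
    · exact Or.inl ⟨hi, if_pos hi, if_pos hi⟩
    · have hi' : ¬ δ (i + 1) = 1 := by omega
      exact Or.inr ⟨hi, if_neg hi', if_neg hi'⟩
  have hpre : SameCoeffs
      (∏ q ∈ Finset.univ.filter
        (fun q : Fin h × Fin h => q.1 < q.2 ∧ δ ((q.1 : ℕ) + 1) > δ ((q.2 : ℕ) + 1)),
        (1 - Urat ((q.1 : ℕ) + 1) ((q.2 : ℕ) + 1))⁻¹)
      (∏ i : Fin h, ∏ j : Fin h, if i < j then
        ESeries.geom (a i * b j * ∏ t ∈ Finset.Ico ((i : ℕ) + 1) (j + 1), MvPowerSeries.X t)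
        else 1) := by
    rw [Finset.prod_filter, ← Finset.univ_product_univ, Finset.prod_product]
    refine SameCoeffs.prod _ fun i => SameCoeffs.prod _ fun j => ?_
    by_cases hij : i < j
    · have hT := (sameCoeffs_Urat (i + 1) (j + 1)).inv_one_sub
        (constantCoeff_Urat (by simpa using hij))
      rcases hsign i with ⟨hi, hai, -⟩ | ⟨hi, hai, -⟩ <;>
      rcases hsign j with ⟨hj, -, hbj⟩ | ⟨hj, -, hbj⟩ <;>
      simp [hij, hi, hj, hai, hbj, SameCoeffs.one, hT]
    · simp [hij, SameCoeffs.one]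
  have hphi : SameCoeffs (Phi fun n => if n < h ∧ δ (n + 1) = -1 then U (n + 1) else 0)
      (ESeries.phiList (List.ofFn fun i : Fin h =>
        b i * ∏ t ∈ Finset.range (i + 1), MvPowerSeries.X t)) := by
    refine SameCoeffs.Phi (fun n hn => if_neg (by omega)) (fun n => ?_) fun i => ?_
    · split_ifs <;> simp [constantCoeff_U]
    · rcases hsign i with ⟨hi, -, hbi⟩ | ⟨hi, -, hbi⟩
      · simp [hi, hbi, SameCoeffs.zero]
      · simpa [hi, hbi] using sameCoeffs_U (i + 1)
  let z : ℕ → Fin h → ESeries := fun k i =>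
    q ^ (k + 1) * (b i * ∏ t ∈ Finset.range (i + 1), MvPowerSeries.X t) +
      q ^ k * (a i * ∏ t ∈ Finset.Ico ((i : ℕ) + 1) (h + 1), MvPowerSeries.X t)
  let f : ℕ → RU := fun k =>
    Phi (fun n => if n < h then
      (if δ (n + 1) = -1 then U (n + 1) * U (h + 1) ^ (k + 1)
        else Urat (n + 1) (h + 1) * U (h + 1) ^ k)
      else 0) * (1 - U (h + 1) ^ (k + 1))⁻¹
  let g : ℕ → ESeries := fun k =>
    ESeries.phiList (List.ofFn (z k)) * ESeries.geom (q ^ (k + 1))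
  have hfg : ∀ k, SameCoeffs (f k) (g k) := fun k => by
    refine (SameCoeffs.Phi (fun n hn => if_neg (by omega)) (fun n => ?_) fun i => ?_).mul
      (((sameCoeffs_U (h + 1)).pow (k + 1)).inv_one_sub (by simp [constantCoeff_U]))
    · split_ifs with hn
      · simp [constantCoeff_U]
      · simp [constantCoeff_Urat (show n + 1 < h + 1 by omega)]
      · simp
    · rcases hsign i with ⟨hi, hai, hbi⟩ | ⟨hi, hai, hbi⟩
      · simpa [z, hi, hai, hbi, mul_comm] using
          (sameCoeffs_Urat (i + 1) (h + 1)).mul ((sameCoeffs_U (h + 1)).pow k)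
      · simpa [z, hi, hai, hbi, mul_comm] using
          (sameCoeffs_U (i + 1)).mul ((sameCoeffs_U (h + 1)).pow (k + 1))
  have hq : MvPowerSeries.constantCoeff q = 0 := by
    simp only [q]
    rw [Finset.prod_range_succ, map_mul, MvPowerSeries.constantCoeff_X, mul_zero]
  have hf : ∀ k, EqBelow k (f k) 1 := fun k => by
    rw [(hfg k).eqBelow_iff SameCoeffs.one]
    have hk := EqBelow.pow_of_constantCoeff hq k
    have hk' : EqBelow k (q ^ (k + 1)) 0 := by
      rw [pow_succ]
      exact hk.mul_right_zero q
    have hz : ∀ x ∈ List.ofFn (z k), EqBelow k x 0 := fun x hx => by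
      obtain ⟨i, rfl⟩ := (List.mem_ofFn' _ _).mp hx
      simpa using (hk'.mul_right_zero _).add (hk.mul_right_zero _)
    simpa using (ESeries.phiList_eqBelow hz).mul hk'.geom
  obtain ⟨P, hP, hPK⟩ := exists_hasProd_eqBelow hf
  rw [hP.tprod_eq]
  refine (SameCoeffs.hasSum (g := fun ω : {L : Fin (h + 1) → Ptn // IsDSPP (h + 1) δ L} =>
    ∏ i : Fin (h + 1), (MvPowerSeries.X i : ESeries) ^ (ω.1 i).size)
    (fun ω => SameCoeffs.prod _ fun i => (SameCoeffs.X i).pow _) fun n => ?_).tsum_eq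
  obtain ⟨k, hk, hk'⟩ := ((hpre.mul hphi).mul
    (SameCoeffs.prod (Finset.range (n.degree + 1)) hfg)).exists_nat n
  refine ⟨k, ?_, ?_⟩
  · rw [← hk]
    exact ((EqBelow.refl _).mul (hPK (n.degree + 1))) n (Nat.lt_succ_self _)
  · rw [← hk', mul_assoc]
    exact ESeries.total_dspp_eqBelow h MvPowerSeries.X (MvPowerSeries.constantCoeff_X 0) δ a b
      rfl rfl (n.degree + 1) n (Nat.lt_succ_self _)
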